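/- For a given N_p, if a clustering C of X is strongly separable, then C is LM-separable. -/

import Mathlib

variable {α : Type*}

/-- Sparsity ε_{N_p}(x): smallest ε ≥ 0 such that at least N_p points of X lie within
distance ε of x. -/
noncomputable def sparsity [MetricSpace α] (X : Finset α) (Np : ℕ) (x : α) : ℝ :=
  sInf {ε : ℝ | 0 ≤ ε ∧ Np ≤ (X.filter (fun y => dist x y ≤ ε)).card}

/-- x is ε-connected to y: there is a finite sequence of points of X from x to y,
each of sparsity at most ε, with consecutive distances at most ε. -/
def EpsConn [MetricSpace α] (X : Finset α) (Np : ℕ) (ε : ℝ) (x y : α) : Prop :=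
  x ∈ X ∧ sparsity X Np x ≤ ε ∧
    Relation.ReflTransGen (fun a b => b ∈ X ∧ sparsity X Np b ≤ ε ∧ dist a b ≤ ε) x y

/-- A set c is ε-connected if every pair of points of c is ε-connected. -/
def SetConn [MetricSpace α] (X : Finset α) (Np : ℕ) (ε : ℝ) (c : Finset α) : Prop :=
  ∀ x ∈ c, ∀ y ∈ c, EpsConn X Np ε x y

/-- ε*(c): the minimum ε such that c is ε-connected. -/
noncomputable def setSparsity [MetricSpace α] (X : Finset α) (Np : ℕ) (c : Finset α) : ℝ :=
  sInf {ε : ℝ | SetConn X Np ε c}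

/-- ε(x,y): the minimum ε such that x is ε-connected to y. -/
noncomputable def epsDist [MetricSpace α] (X : Finset α) (Np : ℕ) (x y : α) : ℝ :=
  sInf {ε : ℝ | EpsConn X Np ε x y}

/-- ε(x,c): min over y ∈ c of ε(x,y). -/
noncomputable def ptClusterDist [MetricSpace α] (X : Finset α) (Np : ℕ) (x : α)
    (c : Finset α) : ℝ :=
  sInf {e : ℝ | ∃ y ∈ c, e = epsDist X Np x y}

/-- ε(c,c'): min over x ∈ c, y ∈ c' of ε(x,y). -/
noncomputable def clusterDist [MetricSpace α] (X : Finset α) (Np : ℕ)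
    (c c' : Finset α) : ℝ :=
  sInf {e : ℝ | ∃ x ∈ c, ∃ y ∈ c', e = epsDist X Np x y}

/-- A clustering of X: a partition of X into nonempty clusters. -/
def IsClustering (X : Finset α) (C : Finset (Finset α)) : Prop :=
  (∀ c ∈ C, c.Nonempty) ∧ (∀ c ∈ C, ∀ c' ∈ C, c ≠ c' → Disjoint c c') ∧
    (∀ c ∈ C, c ⊆ X) ∧ (∀ x ∈ X, ∃ c ∈ C, x ∈ c)

/-- C is weakly separable: for each cluster c, ε*(c) < min over c' ≠ c of ε(c,c'). -/
def WeaklySeparable [MetricSpace α] (X : Finset α) (Np : ℕ) (C : Finset (Finset α)) : Prop :=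
  ∀ c ∈ C, ∀ c' ∈ C, c' ≠ c → setSparsity X Np c < clusterDist X Np c c'

/-- c is an ε-cluster: a (nonempty) maximal ε-connected subset of X. -/
def IsEpsCluster [MetricSpace α] (X : Finset α) (Np : ℕ) (ε : ℝ) (c : Finset α) : Prop :=
  c.Nonempty ∧ SetConn X Np ε c ∧ ∀ x ∈ X, (∃ y ∈ c, EpsConn X Np ε x y) → x ∈ c

/-- c is a maximal cluster: an ε-cluster for some ε ≥ 0. -/
def IsMaximalCluster [MetricSpace α] (X : Finset α) (Np : ℕ) (c : Finset α) : Prop :=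
  ∃ ε : ℝ, 0 ≤ ε ∧ IsEpsCluster X Np ε c

/-- x is a local maximum: every y ∈ X with d(x,y) ≤ ε_{N_p}(x) has sparsity ≥ that of x. -/
def IsLocalMaxPt [MetricSpace α] (X : Finset α) (Np : ℕ) (x : α) : Prop :=
  x ∈ X ∧ ∀ y ∈ X, dist x y ≤ sparsity X Np x → sparsity X Np x ≤ sparsity X Np y

/-- X_c*: the points of c of minimum sparsity within c. -/
noncomputable def minSparsityPts [MetricSpace α] (X : Finset α) (Np : ℕ)
    (c : Finset α) : Finset α :=
  c.filter (fun x => ∀ y ∈ c, sparsity X Np x ≤ sparsity X Np y)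

/-- Relative separability A(x,y) = ε(x,y) / ε_{N_p}(x). -/
noncomputable def relSep [MetricSpace α] (X : Finset α) (Np : ℕ) (x y : α) : ℝ :=
  epsDist X Np x y / sparsity X Np x

/-- A(x,c) = min over y ∈ c of A(x,y). -/
noncomputable def relSepCluster [MetricSpace α] (X : Finset α) (Np : ℕ) (x : α)
    (c : Finset α) : ℝ :=
  sInf {a : ℝ | ∃ y ∈ c, a = relSep X Np x y}

/-- A^ℓ(C): the minimum A such that for every local maximum x, every y in the cluster of x
with sparsity at most that of x satisfies A(x,y) ≤ A. -/
noncomputable def Aell [MetricSpace α] (X : Finset α) (Np : ℕ)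
    (C : Finset (Finset α)) : ℝ :=
  sInf {A : ℝ | ∀ x ∈ X, IsLocalMaxPt X Np x → ∀ c ∈ C, x ∈ c →
    ∀ y ∈ c, sparsity X Np y ≤ sparsity X Np x → relSep X Np x y ≤ A}

/-- C is LM-separable: A^ℓ(C) < min over distinct clusters c, c' and z ∈ X_c* of A(z,c'). -/
def LMSeparable [MetricSpace α] (X : Finset α) (Np : ℕ) (C : Finset (Finset α)) : Prop :=
  ∀ c ∈ C, ∀ c' ∈ C, c ≠ c' → ∀ z ∈ minSparsityPts X Np c,
    Aell X Np C < relSepCluster X Np z c'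

/-- min over x ∈ c of ε_{N_p}(x). -/
noncomputable def minSpars [MetricSpace α] (X : Finset α) (Np : ℕ) (c : Finset α) : ℝ :=
  sInf (sparsity X Np '' (c : Set α))

/-- max over x ∈ c of ε_{N_p}(x). -/
noncomputable def maxSpars [MetricSpace α] (X : Finset α) (Np : ℕ) (c : Finset α) : ℝ :=
  sSup (sparsity X Np '' (c : Set α))

/-- C is strongly separable: there is an A such that each cluster c is
(A · min sparsity of c)-connected and A · min sparsity of c < min over c' ≠ c of ε(c,c'). -/
def StronglySeparable [MetricSpace α] (X : Finset α) (Np : ℕ)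
    (C : Finset (Finset α)) : Prop :=
  ∃ A : ℝ, ∀ c ∈ C, SetConn X Np (A * minSpars X Np c) c ∧
    ∀ c' ∈ C, c' ≠ c → A * minSpars X Np c < clusterDist X Np c c'

/-- c*(x,ε): the set of points of X that are ε-connected to x. -/
def epsClusterAt [MetricSpace α] (X : Finset α) (Np : ℕ) (ε : ℝ) (x : α) : Set α :=
  {y | EpsConn X Np ε x y}

section Sparsity

variable [MetricSpace α] {X : Finset α} {Np : ℕ}

lemma sparsity_nonneg (x : α) : 0 ≤ sparsity X Np x :=
  Real.sInf_nonneg fun _ h => h.1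

lemma sparsity_pos (hNp : 2 ≤ Np) (hNpX : Np ≤ X.card) (x : α) : 0 < sparsity X Np x := by
  classical
  have hne : (X.erase x).Nonempty := by
    rw [← Finset.card_pos]
    have := Finset.pred_card_le_card_erase (s := X) (a := x)
    omega
  obtain ⟨w, hw, hmin⟩ := (X.erase x).exists_min_image (dist x) hne
  refine (dist_pos.2 (Finset.ne_of_mem_erase hw).symm).trans_le (le_csInf ?_ ?_)
  · refine ⟨∑ y ∈ X, dist x y, Finset.sum_nonneg fun _ _ => dist_nonneg, ?_⟩
    rwa [Finset.filter_true_of_mem]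
    exact fun y hy => Finset.single_le_sum (f := dist x) (fun _ _ => dist_nonneg) hy
  · rintro ε ⟨-, hε⟩
    obtain ⟨y, hy, hyx⟩ := Finset.exists_mem_ne (hNp.trans hε) x
    rw [Finset.mem_filter] at hy
    exact (hmin y (Finset.mem_erase.2 ⟨hyx, hy.1⟩)).trans hy.2

lemma epsDist_nonneg (x y : α) : 0 ≤ epsDist X Np x y :=
  Real.sInf_nonneg fun _ h => (sparsity_nonneg x).trans h.2.1

lemma EpsConn.epsDist_le {ε : ℝ} {x y : α} (h : EpsConn X Np ε x y) :
    epsDist X Np x y ≤ ε :=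
  csInf_le ⟨sparsity X Np x, fun _ h => h.2.1⟩ h

lemma clusterDist_le_epsDist {c c' : Finset α} {x y : α} (hx : x ∈ c) (hy : y ∈ c') :
    clusterDist X Np c c' ≤ epsDist X Np x y := by
  refine csInf_le ⟨0, ?_⟩ ⟨x, hx, y, hy, rfl⟩
  rintro _ ⟨u, -, v, -, rfl⟩
  exact epsDist_nonneg u v

lemma minSpars_nonneg (c : Finset α) : 0 ≤ minSpars X Np c := by
  refine Real.sInf_nonneg ?_
  rintro _ ⟨x, -, rfl⟩
  exact sparsity_nonneg x

lemma minSpars_le {c : Finset α} {x : α} (hx : x ∈ c) :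
    minSpars X Np c ≤ sparsity X Np x := by
  refine csInf_le ⟨0, ?_⟩ ⟨x, hx, rfl⟩
  rintro _ ⟨y, -, rfl⟩
  exact sparsity_nonneg y

lemma minSpars_eq {c : Finset α} {z : α} (hz : z ∈ minSparsityPts X Np c) :
    minSpars X Np c = sparsity X Np z := by
  obtain ⟨hzc, hmin⟩ := Finset.mem_filter.1 hz
  refine IsLeast.csInf_eq ⟨⟨z, hzc, rfl⟩, ?_⟩
  rintro _ ⟨y, hy, rfl⟩
  exact hmin y hy

end Sparsity

/-- strong separability implies LM-separability. -/
theorem stmt_5 {α : Type*} [MetricSpace α] (X : Finset α) (Np : ℕ)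
    (hNp : 2 ≤ Np) (hNpX : Np ≤ X.card)
    (C : Finset (Finset α)) (hC : IsClustering X C)
    (hS : StronglySeparable X Np C) :
    LMSeparable X Np C := by
  obtain ⟨A, hA⟩ := hS
  intro c hc c' hc' hne z hz
  have hpos := sparsity_pos hNp hNpX
  have hzc : z ∈ c := (Finset.mem_filter.1 hz).1
  have hA0 : 0 < A :=
    pos_of_mul_pos_left ((hpos z).trans_le ((hA c hc).1 z hzc z hzc).2.1) (minSpars_nonneg c)
  have hAell : Aell X Np C ≤ A := by
    by_cases hb : BddBelow {A : ℝ | ∀ x ∈ X, IsLocalMaxPt X Np x → ∀ c ∈ C, x ∈ c →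
        ∀ y ∈ c, sparsity X Np y ≤ sparsity X Np x → relSep X Np x y ≤ A}
    · refine csInf_le hb fun x _ _ d hd hxd y hyd _ => ?_
      rw [relSep, div_le_iff₀ (hpos x)]
      exact ((hA d hd).1 x hxd y hyd).epsDist_le.trans
        (mul_le_mul_of_nonneg_left (minSpars_le hxd) hA0.le)
    · rw [Aell, Real.sInf_of_not_bddBelow hb]
      exact hA0.le
  have hlt := (hA c hc).2 c' hc' hne.symm
  rw [minSpars_eq hz, ← lt_div_iff₀ (hpos z)] at hlt
  refine hAell.trans_lt (hlt.trans_le (le_csInf ?_ ?_))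
  · obtain ⟨y, hy⟩ := hC.1 c' hc'
    exact ⟨_, y, hy, rfl⟩
  · rintro _ ⟨y, hy, rfl⟩
    exact div_le_div_of_nonneg_right (clusterDist_le_epsDist hzc hy) (hpos z).le
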